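/- Let V be a mixed lattice vector space with generating specific cone V_sp, equipped with a vector topology τ. Then the following are equivalent: (a) τ is locally mixed-full and the mixed lattice operations are continuous at zero; (b) for every neighborhood U of zero there exists a neighborhood W of zero with W ⊆ U and MS₁(W) ⊆ U; (c) for every neighborhood U of zero there exists a neighborhood W of zero with W ⊆ U and MS₂(W) ⊆ U. -/

import Mathlib

/-- A mixed lattice vector space: a real vector space with two partial orders
(the initial order `le` and the specific order `sle`), each making it a partially
ordered vector space, such that the mixed upper and lower envelopes `up` and `down`
exist, `sle` implies `le`, and the specific cone is a mixed lattice cone. -/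
structure MixedLattice (V : Type*) [AddCommGroup V] [Module ℝ V] where
  le : V → V → Prop
  sle : V → V → Prop
  le_refl : ∀ x, le x x
  le_trans : ∀ {x y z}, le x y → le y z → le x z
  le_antisymm : ∀ {x y}, le x y → le y x → x = y
  sle_refl : ∀ x, sle x x
  sle_trans : ∀ {x y z}, sle x y → sle y z → sle x z
  sle_antisymm : ∀ {x y}, sle x y → sle y x → x = y
  le_add : ∀ {x y} (z : V), le x y → le (x + z) (y + z)
  le_smul : ∀ {a : ℝ}, 0 ≤ a → ∀ {x y}, le x y → le (a • x) (a • y)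
  sle_add : ∀ {x y} (z : V), sle x y → sle (x + z) (y + z)
  sle_smul : ∀ {a : ℝ}, 0 ≤ a → ∀ {x y}, sle x y → sle (a • x) (a • y)
  /-- the mixed upper envelope `x ⌣ y` -/
  up : V → V → V
  /-- the mixed lower envelope `x ⌢ y` -/
  down : V → V → V
  up_mem₁ : ∀ x y, sle x (up x y)
  up_mem₂ : ∀ x y, le y (up x y)
  up_min : ∀ x y w, sle x w → le y w → le (up x y) w
  down_mem₁ : ∀ x y, sle (down x y) x
  down_mem₂ : ∀ x y, le (down x y) y
  down_max : ∀ x y w, sle w x → le w y → le w (down x y)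
  sle_imp_le : ∀ {x y}, sle x y → le x y
  up_cone : ∀ {x y}, sle 0 x → sle 0 y → sle 0 (up x y)
  down_cone : ∀ {x y}, sle 0 x → sle 0 y → sle 0 (down x y)

namespace MixedLattice

variable {V : Type*} [AddCommGroup V] [Module ℝ V] (M : MixedLattice V)

/-- the specific upper part `xᵘ = 0 ⌣ x` -/
def supp (x : V) : V := M.up 0 x

/-- the specific lower part `xˡ = 0 ⌣ (-x)` -/
def slowp (x : V) : V := M.up 0 (-x)

/-- the upper part `ᵘx = x ⌣ 0` -/
def upp (x : V) : V := M.up x 0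

/-- the lower part `ˡx = (-x) ⌣ 0` -/
def lowp (x : V) : V := M.up (-x) 0

/-- the symmetric generalized absolute value `s(x) = (1/2)((x⌣(−x)) + ((−x)⌣x))` -/
noncomputable def sabs (x : V) : V := (1 / 2 : ℝ) • (M.up x (-x) + M.up (-x) x)

/-- the type 1 mixed-full hull `MF₁(A) = {y : x ≼ y ≤ z for some x, z ∈ A}` -/
def MF1 (A : Set V) : Set V := {y | ∃ x ∈ A, ∃ z ∈ A, M.sle x y ∧ M.le y z}

/-- the type 2 mixed-full hull `MF₂(A) = {y : x ≤ y ≼ z for some x, z ∈ A}` -/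
def MF2 (A : Set V) : Set V := {y | ∃ x ∈ A, ∃ z ∈ A, M.le x y ∧ M.sle y z}

/-- `MS₁(A) = {y : −s(x) ≼ y ≤ s(x) for some x ∈ A}` -/
def MS1 (A : Set V) : Set V := {y | ∃ x ∈ A, M.sle (-M.sabs x) y ∧ M.le y (M.sabs x)}

/-- `MS₂(A) = {y : −s(x) ≤ y ≼ s(x) for some x ∈ A}` -/
def MS2 (A : Set V) : Set V := {y | ∃ x ∈ A, M.le (-M.sabs x) y ∧ M.sle y (M.sabs x)}

/-- a set is symmetric-solid if `x ∈ A` and `s(y) ≤ s(x)` imply `y ∈ A` -/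
def SymmSolid (A : Set V) : Prop := ∀ x ∈ A, ∀ y, M.le (M.sabs y) (M.sabs x) → y ∈ A

/-- a set is (≤)-full if `x, y ∈ S` and `y ≤ z ≤ x` imply `z ∈ S` -/
def LeFull (S : Set V) : Prop := ∀ x ∈ S, ∀ y ∈ S, ∀ z, M.le y z → M.le z x → z ∈ S

/-- a set is (≼)-full if `x, y ∈ S` and `y ≼ z ≼ x` imply `z ∈ S` -/
def SleFull (S : Set V) : Prop := ∀ x ∈ S, ∀ y ∈ S, ∀ z, M.sle y z → M.sle z x → z ∈ S

/-- a linear subspace, as a set -/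
def IsSubspace (S : Set V) : Prop :=
  (0 : V) ∈ S ∧ (∀ x ∈ S, ∀ y ∈ S, x + y ∈ S) ∧ ∀ (a : ℝ), ∀ x ∈ S, a • x ∈ S

/-- a mixed lattice subspace -/
def IsMLSubspace (S : Set V) : Prop :=
  IsSubspace S ∧ ∀ x ∈ S, ∀ y ∈ S, M.up x y ∈ S ∧ M.down x y ∈ S

section Topology

variable [TopologicalSpace V]

/-- uniform continuity of a map `V → V` with respect to a vector topology -/
def UnifCont (f : V → V) : Prop :=
  ∀ W ∈ nhds (0 : V), ∃ U ∈ nhds (0 : V), ∀ x y : V, x - y ∈ U → f x - f y ∈ W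

/-- uniform continuity of a map `V × V → V` with respect to a vector topology -/
def UnifCont2 (g : V → V → V) : Prop :=
  ∀ W ∈ nhds (0 : V), ∃ U ∈ nhds (0 : V),
    ∀ x x' y y' : V, x - x' ∈ U → y - y' ∈ U → g x y - g x' y' ∈ W

/-- the topology is locally mixed-full: every neighborhood of zero contains a
type 1 mixed-full neighborhood of zero -/
def LocallyMixedFull : Prop :=
  ∀ U ∈ nhds (0 : V), ∃ W ∈ nhds (0 : V), W ⊆ U ∧ M.MF1 W = W

/-- the topology has a neighborhood base at zero of symmetric-solid sets -/
def LocallySymmSolid : Prop :=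
  ∀ U ∈ nhds (0 : V), ∃ W ∈ nhds (0 : V), W ⊆ U ∧ M.SymmSolid W

/-- the topology has a neighborhood base at zero of (≤)-full sets -/
def LocallyLeFull : Prop :=
  ∀ U ∈ nhds (0 : V), ∃ W ∈ nhds (0 : V), W ⊆ U ∧ M.LeFull W

/-- the mixed lattice operations are continuous at zero -/
def ContAtZero : Prop :=
  ContinuousAt (fun p : V × V => M.up p.1 p.2) ((0 : V), (0 : V)) ∧
  ContinuousAt (fun p : V × V => M.down p.1 p.2) ((0 : V), (0 : V))

end Topology

end MixedLattice

namespace MixedLattice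

variable {V : Type*} [AddCommGroup V] [Module ℝ V] (M : MixedLattice V)

lemma le_add_add {a b c d : V} (h : M.le a b) (h' : M.le c d) : M.le (a + c) (b + d) :=
  M.le_trans (M.le_add c h) (by simpa [add_comm] using M.le_add b h')

lemma sle_add_add {a b c d : V} (h : M.sle a b) (h' : M.sle c d) : M.sle (a + c) (b + d) :=
  M.sle_trans (M.sle_add c h) (by simpa [add_comm] using M.sle_add b h')

lemma le_neg_neg {a b : V} (h : M.le a b) : M.le (-b) (-a) := by
  simpa using M.le_add (-a + -b) h

lemma sle_neg_neg {a b : V} (h : M.sle a b) : M.sle (-b) (-a) := by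
  simpa using M.sle_add (-a + -b) h

lemma up_self (x : V) : M.up x x = x :=
  M.le_antisymm (M.up_min _ _ _ (M.sle_refl x) (M.le_refl x)) (M.up_mem₂ x x)

lemma down_self (x : V) : M.down x x = x :=
  M.le_antisymm (M.down_mem₂ x x) (M.down_max _ _ _ (M.sle_refl x) (M.le_refl x))

lemma up_eq_add_up_zero (x y : V) : M.up x y = x + M.up 0 (y - x) := by
  apply M.le_antisymm
  · apply M.up_min
    · simpa [add_comm] using M.sle_add x (M.up_mem₁ 0 (y - x))
    · simpa [add_comm] using M.le_add x (M.up_mem₂ 0 (y - x))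
  · have h := M.up_min 0 (y - x) (M.up x y - x)
      (by simpa [sub_eq_add_neg] using M.sle_add (-x) (M.up_mem₁ x y))
      (by simpa [sub_eq_add_neg] using M.le_add (-x) (M.up_mem₂ x y))
    simpa [add_comm] using M.le_add x h

lemma down_eq_add_sub_up (x y : V) : M.down x y = x + y - M.up y x := by
  apply M.le_antisymm
  · have h := M.up_min y x (x + y - M.down x y)
      (by simpa [sub_eq_add_neg, add_comm, add_left_comm] using
        M.sle_add (x + y) (M.sle_neg_neg (M.down_mem₁ x y)))
      (by simpa [sub_eq_add_neg, add_comm, add_left_comm] using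
        M.le_add (x + y) (M.le_neg_neg (M.down_mem₂ x y)))
    have h' := M.le_add (M.down x y - M.up y x) h
    simpa using h'
  · apply M.down_max
    · simpa [sub_eq_add_neg, add_comm, add_left_comm] using
        M.sle_add (x + y) (M.sle_neg_neg (M.up_mem₁ y x))
    · simpa [sub_eq_add_neg, add_comm, add_left_comm] using
        M.le_add (x + y) (M.le_neg_neg (M.up_mem₂ y x))

lemma zero_sle_sabs (x : V) : M.sle 0 (M.sabs x) := by
  have h := M.sle_add_add (M.up_mem₁ x (-x)) (M.up_mem₁ (-x) x)
  simpa [sabs] using M.sle_smul (by norm_num : (0 : ℝ) ≤ 1 / 2) h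

lemma neg_sabs_sle_zero (x : V) : M.sle (-M.sabs x) 0 := by
  simpa using M.sle_neg_neg (M.zero_sle_sabs x)

lemma le_sabs (x : V) : M.le x (M.sabs x) := by
  have h := M.le_add_add (M.sle_imp_le (M.up_mem₁ x (-x))) (M.up_mem₂ (-x) x)
  have h' := M.le_smul (by norm_num : (0 : ℝ) ≤ 1 / 2) h
  rwa [← two_smul ℝ x, smul_smul, one_div_mul_cancel two_ne_zero, one_smul] at h'

lemma mem_MS1_of_le {A : Set V} {x y : V} (hx : x ∈ A) (hy : M.sle 0 y) (hyx : M.le y x) :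
    y ∈ M.MS1 A :=
  ⟨x, hx, M.sle_trans (M.neg_sabs_sle_zero x) hy, M.le_trans hyx (M.le_sabs x)⟩

lemma up_zero_mem_MS1 {A : Set V} {x : V} (hx : x ∈ A) : M.up 0 x ∈ M.MS1 A :=
  ⟨x, hx, M.sle_trans (M.neg_sabs_sle_zero x) (M.up_mem₁ 0 x),
    M.up_min _ _ _ (M.zero_sle_sabs x) (M.le_sabs x)⟩

lemma neg_mem_MS2 {A : Set V} {y : V} : -y ∈ M.MS2 A ↔ y ∈ M.MS1 A := by
  constructor
  · rintro ⟨x, hx, h₁, h₂⟩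
    exact ⟨x, hx, by simpa using M.sle_neg_neg h₂, by simpa using M.le_neg_neg h₁⟩
  · rintro ⟨x, hx, h₁, h₂⟩
    exact ⟨x, hx, M.le_neg_neg h₂, by simpa using M.sle_neg_neg h₁⟩

lemma subset_MF1 (A : Set V) : A ⊆ M.MF1 A :=
  fun x hx => ⟨x, hx, x, hx, M.sle_refl x, M.le_refl x⟩

lemma MF1_MF1 (A : Set V) : M.MF1 (M.MF1 A) = M.MF1 A := by
  refine Set.Subset.antisymm ?_ (M.subset_MF1 _)
  rintro y ⟨x, ⟨a, ha, -, -, hax, -⟩, z, ⟨-, -, b, hb, -, hzb⟩, hxy, hyz⟩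
  exact ⟨a, ha, b, hb, M.sle_trans hax hxy, M.le_trans hyz hzb⟩

section Topology

variable [TopologicalSpace V] [IsTopologicalAddGroup V]

open Filter Topology

lemma ContAtZero.tendsto_sabs [ContinuousConstSMul ℝ V] (h : M.ContAtZero) :
    Tendsto M.sabs (𝓝 0) (𝓝 0) := by
  have hup : Tendsto (fun p : V × V => M.up p.1 p.2) (𝓝 (0, 0)) (𝓝 0) := by
    simpa [ContinuousAt, up_self] using h.1
  have hneg : Tendsto (fun x : V => -x) (𝓝 0) (𝓝 0) := by
    simpa using (continuous_neg (G := V)).tendsto 0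
  have h₁ := hup.comp (tendsto_id.prodMk_nhds hneg)
  have h₂ := hup.comp (hneg.prodMk_nhds tendsto_id)
  have h₃ := (h₁.add h₂).const_smul (1 / 2 : ℝ)
  rw [add_zero, smul_zero] at h₃
  exact h₃

lemma MS1_subset_of_locallyMixedFull [ContinuousConstSMul ℝ V] (hfull : M.LocallyMixedFull)
    (hcont : M.ContAtZero) {U : Set V} (hU : U ∈ 𝓝 0) :
    ∃ W ∈ 𝓝 (0 : V), W ⊆ U ∧ M.MS1 W ⊆ U := by
  obtain ⟨F, hF, hFU, hFF⟩ := hfull U hU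
  have hs := hcont.tendsto_sabs
  have hs' : Tendsto (fun x => -M.sabs x) (𝓝 0) (𝓝 0) := by simpa using hs.neg
  refine ⟨U ∩ (M.sabs ⁻¹' F ∩ (fun x => -M.sabs x) ⁻¹' F),
    inter_mem hU (inter_mem (hs hF) (hs' hF)), Set.inter_subset_left, ?_⟩
  rintro y ⟨x, ⟨-, hx₁, hx₂⟩, h₁, h₂⟩
  exact hFU (hFF ▸ ⟨_, hx₂, _, hx₁, h₁, h₂⟩)

lemma locallyMixedFull_of_MS1_subset
    (h : ∀ U ∈ 𝓝 (0 : V), ∃ W ∈ 𝓝 (0 : V), W ⊆ U ∧ M.MS1 W ⊆ U) :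
    M.LocallyMixedFull := by
  intro U hU
  obtain ⟨U', hU', hadd⟩ := exists_nhds_zero_half hU
  obtain ⟨W, hW, -, hWU⟩ := h U' hU'
  obtain ⟨N, hN, hsub⟩ := exists_nhds_half_neg hW
  have hNU : N ∩ U' ∈ 𝓝 (0 : V) := inter_mem hN hU'
  refine ⟨M.MF1 (N ∩ U'), mem_of_superset hNU (M.subset_MF1 _), ?_, M.MF1_MF1 _⟩
  rintro y ⟨x, hx, z, hz, hxy, hyz⟩
  have hy : y - x ∈ M.MS1 W := M.mem_MS1_of_le (hsub z hz.1 x hx.1)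
    (by simpa [sub_eq_add_neg] using M.sle_add (-x) hxy)
    (by simpa [sub_eq_add_neg] using M.le_add (-x) hyz)
  simpa using hadd x hx.2 _ (hWU hy)

lemma contAtZero_of_MS1_subset
    (h : ∀ U ∈ 𝓝 (0 : V), ∃ W ∈ 𝓝 (0 : V), W ⊆ U ∧ M.MS1 W ⊆ U) :
    M.ContAtZero := by
  have hzero : Tendsto (M.up 0) (𝓝 0) (𝓝 0) := by
    intro U hU
    obtain ⟨W, hW, -, hWU⟩ := h U hU
    exact mem_map.2 (mem_of_superset hW fun x hx => hWU (M.up_zero_mem_MS1 hx))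
  have hfst : Tendsto (fun p : V × V => p.1) (𝓝 (0, 0)) (𝓝 0) := continuous_fst.tendsto _
  have hsnd : Tendsto (fun p : V × V => p.2) (𝓝 (0, 0)) (𝓝 0) := continuous_snd.tendsto _
  have hup : ∀ {f g : V × V → V}, Tendsto f (𝓝 (0, 0)) (𝓝 0) → Tendsto g (𝓝 (0, 0)) (𝓝 0) →
      Tendsto (fun p => M.up (f p) (g p)) (𝓝 (0, 0)) (𝓝 0) := by
    intro f g hf hg
    simp_rw [M.up_eq_add_up_zero (f _)]
    have hgf : Tendsto (fun p => g p - f p) (𝓝 (0, 0)) (𝓝 0) := by simpa using hg.sub hf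
    simpa using hf.add (hzero.comp hgf)
  constructor
  · simpa [ContinuousAt, up_self] using hup hfst hsnd
  · have hdown := (hfst.add hsnd).sub (hup hsnd hfst)
    simp_rw [ContinuousAt, down_self, M.down_eq_add_sub_up]
    simpa using hdown

lemma forall_MS1_subset_iff_forall_MS2_subset :
    (∀ U ∈ 𝓝 (0 : V), ∃ W ∈ 𝓝 (0 : V), W ⊆ U ∧ M.MS1 W ⊆ U) ↔
      ∀ U ∈ 𝓝 (0 : V), ∃ W ∈ 𝓝 (0 : V), W ⊆ U ∧ M.MS2 W ⊆ U := by
  have hneg : ∀ U ∈ 𝓝 (0 : V), U ∩ Neg.neg ⁻¹' U ∈ 𝓝 (0 : V) := fun U hU =>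
    inter_mem hU ((continuous_neg (G := V)).tendsto 0 (by simpa using hU))
  constructor
  · intro h U hU
    obtain ⟨W, hW, hWU, hMS⟩ := h _ (hneg U hU)
    refine ⟨W, hW, hWU.trans Set.inter_subset_left, fun y hy => ?_⟩
    have hy' : -y ∈ M.MS1 W := M.neg_mem_MS2.1 (by simpa using hy)
    simpa using (hMS hy').2
  · intro h U hU
    obtain ⟨W, hW, hWU, hMS⟩ := h _ (hneg U hU)
    refine ⟨W, hW, hWU.trans Set.inter_subset_left, fun y hy => ?_⟩
    simpa using (hMS (M.neg_mem_MS2.2 hy)).2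

end Topology

end MixedLattice

/-- for a mixed lattice space with generating specific cone and a vector
topology, local mixed-fullness together with continuity of the mixed lattice operations
at zero is equivalent to the `MS₁` (equivalently `MS₂`) neighborhood conditions. -/
theorem stmt_8 {V : Type*} [AddCommGroup V] [Module ℝ V] (M : MixedLattice V)
    [TopologicalSpace V] [ContinuousAdd V] [ContinuousSMul ℝ V]
    (hgen : ∀ v : V, ∃ a b : V, M.sle 0 a ∧ M.sle 0 b ∧ v = a - b) :
    List.TFAE
      [ M.LocallyMixedFull ∧ M.ContAtZero,
        ∀ U ∈ nhds (0 : V), ∃ W ∈ nhds (0 : V), W ⊆ U ∧ M.MS1 W ⊆ U,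
        ∀ U ∈ nhds (0 : V), ∃ W ∈ nhds (0 : V), W ⊆ U ∧ M.MS2 W ⊆ U ] := by
  have : IsTopologicalAddGroup V :=
    { continuous_neg := by simpa using! continuous_const_smul (T := V) (-1 : ℝ) }
  tfae_have 1 → 2 := fun h _ hU => M.MS1_subset_of_locallyMixedFull h.1 h.2 hU
  tfae_have 2 → 1 := fun h =>
    ⟨M.locallyMixedFull_of_MS1_subset h, M.contAtZero_of_MS1_subset h⟩
  tfae_have 2 ↔ 3 := M.forall_MS1_subset_iff_forall_MS2_subset
  tfae_finish
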